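/- Uniform Gronwall's Lemma: Let g, h, y be three locally integrable nonnegative functions on the time interval [0, ∞) with y absolutely continuous, satisfying dy/dt ≤ g(t) y(t) + h(t) for all t ≥ 0. Suppose there exist positive constants T, α₁, α₂, α₃ such that ∫_t^{t+T} g(s) ds ≤ α₁, ∫_t^{t+T} h(s) ds ≤ α₂, and ∫_t^{t+T} y(s) ds ≤ α₃ for all t ≥ 0. Then y(t+T) ≤ (α₃/T + α₂) exp(α₁) for all t ≥ 0. -/

import Mathlib

open MeasureTheory

/-- A Lipschitz function composed with an absolutely continuous one is absolutely continuous. -/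
theorem LipschitzOnWith.comp_absolutelyContinuousOnInterval {φ f : ℝ → ℝ} {K : NNReal}
    {S : Set ℝ} {a b : ℝ} (hφ : LipschitzOnWith K φ S)
    (hf : AbsolutelyContinuousOnInterval f a b) (hS : Set.MapsTo f (Set.uIcc a b) S) :
    AbsolutelyContinuousOnInterval (fun x => φ (f x)) a b := by
  have hK := hf.const_mul (K : ℝ)
  rw [absolutelyContinuousOnInterval_iff] at hK ⊢
  intro ε hε
  obtain ⟨δ, hδ, H⟩ := hK ε hε
  refine ⟨δ, hδ, fun E hE hlen => (Finset.sum_le_sum fun i hi => ?_).trans_lt (H E hE hlen)⟩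
  have hmem := hE.1 i hi
  refine (hφ.dist_le_mul _ (hS hmem.1) _ (hS hmem.2)).trans_eq ?_
  simp [Real.dist_eq, ← mul_sub, abs_mul]

theorem AbsolutelyContinuousOnInterval.exp_of_nonpos {f : ℝ → ℝ} {a b : ℝ}
    (hf : AbsolutelyContinuousOnInterval f a b) (hf0 : ∀ x ∈ Set.uIcc a b, f x ≤ 0) :
    AbsolutelyContinuousOnInterval (fun x => Real.exp (f x)) a b := by
  have hexp : LipschitzOnWith 1 Real.exp (Set.Iic 0) := by
    refine (convex_Iic 0).lipschitzOnWith_of_nnnorm_deriv_le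
      (fun x _ => Real.differentiableAt_exp) fun x hx => ?_
    rw [Real.deriv_exp, ← NNReal.coe_le_coe, coe_nnnorm, Real.norm_eq_abs, Real.abs_exp]
    simpa using hx
  exact hexp.comp_absolutelyContinuousOnInterval hf hf0

/-- Gronwall's inequality for an absolutely continuous function, with integrable coefficients. -/
theorem AbsolutelyContinuousOnInterval.le_exp_integral_mul {y g h : ℝ → ℝ} {a b : ℝ}
    (hab : a ≤ b) (hy : AbsolutelyContinuousOnInterval y a b)
    (hg : IntervalIntegrable g volume a b) (hh : IntervalIntegrable h volume a b)
    (hg0 : ∀ x ∈ Set.Icc a b, 0 ≤ g x) (hh0 : ∀ x ∈ Set.Icc a b, 0 ≤ h x)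
    (hineq : ∀ᵐ x, x ∈ Set.Icc a b → deriv y x ≤ g x * y x + h x) :
    y b ≤ (y a + ∫ x in a..b, h x) * Real.exp (∫ x in a..b, g x) := by
  set G : ℝ → ℝ := fun x => ∫ s in a..x, g s with hGdef
  have hGnonneg : ∀ x ∈ Set.uIcc a b, 0 ≤ G x := fun x hx => by
    rw [Set.uIcc_of_le hab] at hx
    exact intervalIntegral.integral_nonneg hx.1 fun s hs => hg0 s ⟨hs.1, hs.2.trans hx.2⟩
  have hG : AbsolutelyContinuousOnInterval G a b :=
    hg.absolutelyContinuousOnInterval_intervalIntegral (by simp)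
  have hE : AbsolutelyContinuousOnInterval (fun x => Real.exp (-G x)) a b :=
    hG.neg.exp_of_nonpos fun x hx => neg_nonpos.2 (hGnonneg x hx)
  have hF := hy.fun_mul hE
  have hle : ∫ x in a..b, deriv (fun x => y x * Real.exp (-G x)) x ≤ ∫ x in a..b, h x := by
    refine intervalIntegral.integral_mono_ae_restrict hab hF.intervalIntegrable_deriv hh ?_
    filter_upwards [ae_restrict_mem measurableSet_Icc, ae_restrict_of_ae hineq,
      ae_restrict_of_ae hy.ae_differentiableAt,
      ae_restrict_of_ae hg.ae_hasDerivAt_integral] with x hx hx1 hx2 hx3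
    have hx' : x ∈ Set.uIcc a b := by rwa [Set.uIcc_of_le hab]
    have hd := (hx2 hx').hasDerivAt.mul (hx3 hx' a (by simp)).neg.exp
    have hE1 : Real.exp (-G x) ≤ 1 := by simpa using hGnonneg x hx'
    calc deriv (fun x => y x * Real.exp (-G x)) x
        = deriv y x * Real.exp (-G x) + y x * (Real.exp (-G x) * -g x) := hd.deriv
      _ = (deriv y x - g x * y x) * Real.exp (-G x) := by ring
      _ ≤ h x * Real.exp (-G x) := by gcongr; linarith [hx1 hx]
      _ ≤ h x := mul_le_of_le_one_right (hh0 x hx) hE1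
  rw [hF.integral_deriv_eq_sub] at hle
  have hGa : G a = 0 := by simp [hGdef]
  simp only [hGa, neg_zero, Real.exp_zero, mul_one] at hle
  calc y b = y b * Real.exp (-G b) * Real.exp (G b) := by
        rw [mul_assoc, ← Real.exp_add]; simp
    _ ≤ (y a + ∫ x in a..b, h x) * Real.exp (G b) := by gcongr; linarith



/-- **Uniform Gronwall's Lemma.**
Let `g, h, y` be three locally integrable nonnegative functions on `[0, ∞)`, with `y`
absolutely continuous (encoded: `y t = y 0 + ∫₀ᵗ y'` for a locally integrable `y'`),
satisfying `dy/dt ≤ g y + h` almost everywhere on `[0, ∞)`.  If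
`∫_t^{t+T} g ≤ α₁`, `∫_t^{t+T} h ≤ α₂` and `∫_t^{t+T} y ≤ α₃` for all `t ≥ 0`,
where `T, α₁, α₂, α₃` are positive constants, then
`y (t + T) ≤ (α₃ / T + α₂) * exp α₁` for all `t ≥ 0`. -/
theorem uniform_gronwall_lemma
    (g h y y' : ℝ → ℝ) (T α₁ α₂ α₃ : ℝ)
    (hT : 0 < T) (hα₁ : 0 < α₁) (hα₂ : 0 < α₂) (hα₃ : 0 < α₃)
    (hg_nonneg : ∀ t, 0 ≤ t → 0 ≤ g t)
    (hh_nonneg : ∀ t, 0 ≤ t → 0 ≤ h t)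
    (hy_nonneg : ∀ t, 0 ≤ t → 0 ≤ y t)
    (hg_loc : LocallyIntegrableOn g (Set.Ici 0))
    (hh_loc : LocallyIntegrableOn h (Set.Ici 0))
    (hy_loc : LocallyIntegrableOn y (Set.Ici 0))
    -- `y` is absolutely continuous on `[0, ∞)` with a.e. derivative `y'`
    (hy'_loc : LocallyIntegrableOn y' (Set.Ici 0))
    (hy_ac : ∀ t, 0 ≤ t → y t = y 0 + ∫ s in (0:ℝ)..t, y' s)
    -- the differential inequality `dy/dt ≤ g y + h` holds a.e. on `[0, ∞)`
    (hineq : ∀ᵐ t : ℝ, 0 ≤ t → y' t ≤ g t * y t + h t)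
    (hg_int : ∀ t, 0 ≤ t → (∫ s in t..(t+T), g s) ≤ α₁)
    (hh_int : ∀ t, 0 ≤ t → (∫ s in t..(t+T), h s) ≤ α₂)
    (hy_int : ∀ t, 0 ≤ t → (∫ s in t..(t+T), y s) ≤ α₃) :
    ∀ t, 0 ≤ t → y (t + T) ≤ (α₃ / T + α₂) * Real.exp α₁ := by
  intro t ht
  have hII : ∀ f : ℝ → ℝ, LocallyIntegrableOn f (Set.Ici 0) → ∀ a b, 0 ≤ a → 0 ≤ b →
      IntervalIntegrable f volume a b := fun f hf a b ha hb =>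
    (hf.integrableOn_compact_subset (fun x hx => (le_min ha hb).trans hx.1)
      isCompact_uIcc).intervalIntegrable
  have htT : 0 ≤ t + T := by linarith
  have hy_abs : AbsolutelyContinuousOnInterval y 0 (t + T) := by
    have hint : AbsolutelyContinuousOnInterval (fun x => y 0 + ∫ s in (0:ℝ)..x, y' s) 0 (t + T) :=
      (LipschitzWith.const (y 0)).lipschitzOnWith.absolutelyContinuousOnInterval.add
        ((hII y' hy'_loc 0 (t + T) le_rfl htT).absolutelyContinuousOnInterval_intervalIntegral
          (by simp))
    rw [absolutelyContinuousOnInterval_iff] at hint ⊢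
    intro ε hε
    obtain ⟨δ, hδ, H⟩ := hint ε hε
    refine ⟨δ, hδ, fun E hE hlen => (Finset.sum_congr rfl fun i hi => ?_).trans_lt (H E hE hlen)⟩
    have hmem := hE.1 i hi
    rw [Set.uIcc_of_le htT] at hmem
    rw [hy_ac _ hmem.1.1, hy_ac _ hmem.2.1]
  have hderiv : ∀ᵐ x, x ∈ Set.Icc 0 (t + T) → deriv y x ≤ g x * y x + h x := by
    filter_upwards [hineq, (hII y' hy'_loc 0 (t + T) le_rfl htT).ae_hasDerivAt_integral,
      Measure.ae_ne volume (0 : ℝ)] with x hx1 hx2 hx0 hx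
    have hd := (hx2 (by rwa [Set.uIcc_of_le htT]) 0 (by simp)).const_add (y 0)
    have heq : y =ᶠ[nhds x] fun x => y 0 + ∫ s in (0:ℝ)..x, y' s := by
      filter_upwards [Ioi_mem_nhds (lt_of_le_of_ne hx.1 hx0.symm)] with z hz
      exact hy_ac z (le_of_lt hz)
    rw [(hd.congr_of_eventuallyEq heq).deriv]
    exact hx1 hx.1
  have hpoint : ∀ s ∈ Set.Icc t (t + T), y (t + T) ≤ (y s + α₂) * Real.exp α₁ := by
    intro s hs
    have hs0 : 0 ≤ s := ht.trans hs.1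
    have hsub : ∀ f : ℝ → ℝ, LocallyIntegrableOn f (Set.Ici 0) → (∀ x, 0 ≤ x → 0 ≤ f x) →
        ∫ x in s..(t + T), f x ≤ ∫ x in t..(t + T), f x := fun f hf hf0 => by
      refine intervalIntegral.integral_mono_interval hs.1 hs.2 le_rfl ?_
        (hII f hf _ _ ht htT)
      filter_upwards [ae_restrict_mem measurableSet_Ioc] with x hx
      exact hf0 x (ht.trans hx.1.le)
    have hgron := (hy_abs.mono (c := s) (d := t + T) (by
        rw [Set.uIcc_of_le hs.2, Set.uIcc_of_le htT]
        exact Set.Icc_subset_Icc_left hs0)).le_exp_integral_mul hs.2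
      (hII g hg_loc _ _ hs0 htT) (hII h hh_loc _ _ hs0 htT)
      (fun x hx => hg_nonneg x (hs0.trans hx.1)) (fun x hx => hh_nonneg x (hs0.trans hx.1))
      (by filter_upwards [hderiv] with x hx hxs using hx ⟨hs0.trans hxs.1, hxs.2⟩)
    have hg1 := (hsub g hg_loc hg_nonneg).trans (hg_int t ht)
    have hh1 := (hsub h hh_loc hh_nonneg).trans (hh_int t ht)
    have hys := hy_nonneg s hs0
    refine hgron.trans ?_
    gcongr
  have hyI := hII y hy_loc t (t + T) ht htT
  have havg : ∫ _ in t..(t + T), y (t + T) ≤ ∫ s in t..(t + T), (y s + α₂) * Real.exp α₁ :=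
    intervalIntegral.integral_mono_on (by linarith) intervalIntegrable_const
      ((hyI.add intervalIntegrable_const).mul_const _) hpoint
  rw [intervalIntegral.integral_mul_const,
    intervalIntegral.integral_add hyI intervalIntegrable_const] at havg
  simp only [intervalIntegral.integral_const, add_sub_cancel_left, smul_eq_mul] at havg
  have hbound : T * y (t + T) ≤ (α₃ + T * α₂) * Real.exp α₁ :=
    havg.trans (by gcongr; exact hy_int t ht)
  calc y (t + T) ≤ (α₃ + T * α₂) * Real.exp α₁ / T := by rwa [le_div_iff₀' hT]
    _ = (α₃ / T + α₂) * Real.exp α₁ := by field_simp
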